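/- For every real number y, lim_{n→∞} (1/n)·#{i : 3 ≤ i ≤ n, ω(i) - log log n ≤ y·√(log log n)} = Φ(y), where Φ is the cumulative distribution function of the standard normal distribution, Φ(y) = (1/√(2π))·∫_{-∞}^{y} e^{-t²/2} dt. (Erdős–Kac theorem: the distribution of the number of prime divisors, centered at log log n and scaled by √(log log n), tends to the standard normal distribution.) -/

import Mathlib

open Filter Real

/-- Mertens' first theorem: `∑_{p ≤ n} log p / p = log n + O(1)`. -/
theorem exists_abs_sum_log_div_prime_sub_log_le :
    ∃ C : ℝ, ∀ n : ℕ, 1 ≤ n →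
      |∑ p ∈ n.primesLE, Real.log p / p - Real.log n| ≤ C := by
  have hnonneg (m : ℕ) : 0 ≤ Real.log m / (m * (m - 1)) := by
    rcases m with _ | m
    · simp
    · push_cast
      have := Real.log_natCast_nonneg (m + 1)
      push_cast at this
      have h2 : (0 : ℝ) ≤ (m + 1) * (m + 1 - 1) := by
        rw [add_sub_cancel_right]; positivity
      positivity
  have hsum : Summable fun m : ℕ => Real.log m / (m * (m - 1)) := by
    refine Summable.of_nonneg_of_le hnonneg (fun m => ?_)
      ((Real.summable_nat_rpow_inv (p := 3 / 2)).2 (by norm_num) |>.mul_left 4)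
    rcases Nat.lt_or_ge m 2 with hm | hm
    · interval_cases m <;> simp
    · have hm' : (2 : ℝ) ≤ m := by exact_mod_cast hm
      have hlog : Real.log m ≤ 2 * (m : ℝ) ^ (1 / 2 : ℝ) := by
        have := Real.log_le_rpow_div (x := m) (by positivity) (ε := 1 / 2) (by norm_num)
        linarith
      have hpow : (m : ℝ) ^ (3 / 2 : ℝ) * (m : ℝ) ^ (1 / 2 : ℝ) = m * m := by
        rw [← Real.rpow_add (by positivity)]; norm_num [sq]
      have h3 : 0 < (m : ℝ) ^ (3 / 2 : ℝ) := by positivity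
      have hd : (0 : ℝ) < m * (m - 1) := by nlinarith
      rw [div_le_iff₀ hd, ← div_eq_mul_inv, div_mul_eq_mul_div, le_div_iff₀ h3]
      nlinarith [mul_le_mul_of_nonneg_left hlog h3.le]
  set B := ∑' m : ℕ, Real.log m / (m * (m - 1))
  have hlogfac (n : ℕ) : Real.log n.factorial =
      ∑ p ∈ n.primesLE, (n.factorial.factorization p : ℝ) * Real.log p := by
    conv_lhs => rw [← Nat.prod_factorization_pow_eq_self n.factorial_ne_zero]
    rw [Finsupp.prod_of_support_subset (s := n.primesLE)]
    · push_cast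
      rw [Real.log_prod]
      · exact Finset.sum_congr rfl fun p _ => by rw [Real.log_pow]
      · intro p hp
        have := (Nat.prime_of_mem_primesLE hp).pos
        positivity
    · intro p hp
      rw [Nat.support_factorization, Nat.mem_primeFactors] at hp
      exact Nat.mem_primesLE.2 ⟨(hp.1.dvd_factorial).1 hp.2.1, hp.1⟩
    · simp
  refine ⟨1 + B + Real.log 4, fun n hn => ?_⟩
  have hn0 : (0 : ℝ) < n := by exact_mod_cast hn
  have hB : 0 ≤ B := tsum_nonneg hnonneg
  have h4 : 0 ≤ Real.log 4 := Real.log_nonneg (by norm_num)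
  rw [abs_le]
  constructor
  · have h1 : Real.log n.factorial ≤
        n * ∑ p ∈ n.primesLE, (Real.log p / p + Real.log p / (p * (p - 1))) := by
      rw [hlogfac, Finset.mul_sum]
      refine Finset.sum_le_sum fun p hp => ?_
      have hp' := Nat.prime_of_mem_primesLE hp
      have hp2 : (2 : ℝ) ≤ p := by exact_mod_cast hp'.two_le
      have h := Nat.sub_one_mul_factorization_factorial (n := n) hp'
      have h' : ((p : ℝ) - 1) * n.factorial.factorization p ≤ n := by
        have : (p - 1) * n.factorial.factorization p ≤ n := by rw [h]; exact Nat.sub_le _ _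
        have h5 : (((p - 1 : ℕ) : ℝ)) * n.factorial.factorization p ≤ n := by exact_mod_cast this
        rwa [Nat.cast_sub hp'.one_le, Nat.cast_one] at h5
      have hlp : 0 ≤ Real.log p := Real.log_natCast_nonneg p
      have he : (n : ℝ) * (Real.log p / p + Real.log p / (p * (p - 1))) =
          n / (p - 1) * Real.log p := by
        have : (p : ℝ) - 1 ≠ 0 := by linarith
        field_simp
        ring
      rw [he]
      refine mul_le_mul_of_nonneg_right ?_ hlp
      rw [le_div_iff₀ (by linarith)]
      linarith
    have h2 := Stirling.le_log_factorial_stirling (n := n) (by omega)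
    have h3 : ∑ p ∈ n.primesLE, Real.log p / (p * (p - 1)) ≤ B :=
      hsum.sum_le_tsum _ fun m _ => hnonneg m
    have h5 : 0 ≤ Real.log n := Real.log_natCast_nonneg n
    have h6 : 0 ≤ Real.log (2 * π) := Real.log_nonneg (by nlinarith [Real.pi_gt_three])
    rw [Finset.sum_add_distrib] at h1
    have h7 : n * (Real.log n - 1) ≤ n * (∑ p ∈ n.primesLE, Real.log p / p + B) := by
      nlinarith [mul_le_mul_of_nonneg_left h3 hn0.le]
    have := le_of_mul_le_mul_left h7 hn0
    linarith
  · have h1 : n * ∑ p ∈ n.primesLE, Real.log p / p - Chebyshev.theta n ≤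
        Real.log n.factorial := by
      rw [hlogfac, Finset.mul_sum, Chebyshev.theta_eq_sum_primesLE_log, ← Finset.sum_sub_distrib]
      refine Finset.sum_le_sum fun p hp => ?_
      have hp' := Nat.prime_of_mem_primesLE hp
      have hlp : 0 ≤ Real.log p := Real.log_natCast_nonneg p
      have hdvd : n / p ≤ n.factorial.factorization p := by
        have hp0 := hp'.pos
        rw [← hp'.pow_dvd_iff_le_factorization n.factorial_ne_zero]
        have := hp'.pow_dvd_factorial_iff (n := n) (r := n / p) (b := Nat.log p n + 2) (by omega)
        rw [this]
        have h1 : (1 : ℕ) ∈ Finset.Ico 1 (Nat.log p n + 2) := by simp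
        simpa using Finset.single_le_sum (f := fun i => n / p ^ i) (fun _ _ => Nat.zero_le _) h1
      have h2 : (n : ℝ) / p - 1 ≤ n.factorial.factorization p := by
        have h3 : (n : ℝ) / p - 1 ≤ (n / p : ℕ) := by
          rw [← Nat.floor_div_eq_div (K := ℝ)]
          exact (Nat.sub_one_lt_floor _).le
        exact h3.trans (by exact_mod_cast hdvd)
      calc (n : ℝ) * (Real.log p / p) - Real.log p = (n / p - 1) * Real.log p := by ring
        _ ≤ _ := mul_le_mul_of_nonneg_right h2 hlp
    have h2 := Chebyshev.theta_le_log4_mul_x hn0.le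
    have h3 : Real.log n.factorial ≤ n * Real.log n := by
      rw [← Real.log_pow]
      refine Real.log_le_log (by exact_mod_cast n.factorial_pos) ?_
      exact_mod_cast n.factorial_le_pow
    have h7 : n * ∑ p ∈ n.primesLE, Real.log p / p ≤ n * (Real.log n + Real.log 4) := by
      nlinarith
    have := le_of_mul_le_mul_left h7 hn0
    linarith

/-- Mertens' second theorem: `∑_{p ≤ n} 1 / p = log log n + O(1)`. -/
theorem exists_abs_sum_inv_prime_sub_loglog_le :
    ∃ C : ℝ, ∀ n : ℕ, 2 ≤ n →
      |∑ p ∈ n.primesLE, (p : ℝ)⁻¹ - Real.log (Real.log n)| ≤ C := by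
  obtain ⟨C, hC⟩ := exists_abs_sum_log_div_prime_sub_log_le
  have hC0 : 0 ≤ C := (abs_nonneg _).trans (hC 1 le_rfl)
  set R : ℕ → ℝ := fun n => ∑ p ∈ n.primesLE, Real.log p / p - Real.log n with hR
  set F : ℕ → ℝ := fun n =>
    ∑ p ∈ n.primesLE, (p : ℝ)⁻¹ - Real.log (Real.log n) - R n / Real.log n with hF
  have hl2 : 0 < Real.log 2 := Real.log_pos (by norm_num)
  have hstep (n : ℕ) (hn : 2 ≤ n) :
      |F (n + 1) - F n| ≤ (C + 1) * ((Real.log n)⁻¹ - (Real.log (n + 1 : ℕ))⁻¹) := by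
    have hn2 : (2 : ℝ) ≤ n := by exact_mod_cast hn
    set a := Real.log n with ha
    set b := Real.log (n + 1 : ℕ) with hb
    have ha0 : 0 < a := Real.log_pos (by linarith)
    have hab : a < b := Real.log_lt_log (by linarith) (by push_cast; linarith)
    have hb0 : 0 < b := ha0.trans hab
    have hba : b - a ≤ 1 := by
      rw [hb, ha, ← Real.log_div (by positivity) (by positivity)]
      refine (Real.log_le_sub_one_of_pos (by positivity)).trans ?_
      push_cast
      rw [add_div, div_self (by positivity), add_sub_cancel_left, div_le_one (by positivity)]
      linarith
    have hP : ∑ p ∈ (n + 1).primesLE, (p : ℝ)⁻¹ - ∑ p ∈ n.primesLE, (p : ℝ)⁻¹ =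
        (b - a + (R (n + 1) - R n)) / b := by
      simp only [hR]
      rw [Nat.primesLE_succ]
      split_ifs with h
      · rw [Finset.sum_insert (Nat.notMem_primesLE n), Finset.sum_insert (Nat.notMem_primesLE n)]
        rw [← ha, ← hb]
        field_simp
        ring
      · rw [← ha, ← hb]
        ring
    have hkey : F (n + 1) - F n = ((b - a) / b - (Real.log b - Real.log a)) +
        R n * (a⁻¹ - b⁻¹) := by
      have : F (n + 1) - F n =
          (∑ p ∈ (n + 1).primesLE, (p : ℝ)⁻¹ - ∑ p ∈ n.primesLE, (p : ℝ)⁻¹) -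
          (Real.log b - Real.log a) - R (n + 1) / b + R n / a := by
        simp only [hF]; rw [← ha, ← hb]; ring
      rw [this, hP]
      field_simp
      ring
    have hinv : 0 ≤ a⁻¹ - b⁻¹ := sub_nonneg.2 (inv_anti₀ ha0 hab.le)
    have h1 : (b - a) / b ≤ Real.log b - Real.log a := by
      rw [← Real.log_div hb0.ne' ha0.ne']
      have := Real.one_sub_inv_le_log_of_pos (x := b / a) (by positivity)
      rwa [inv_div, one_sub_div hb0.ne'] at this
    have h2 : Real.log b - Real.log a ≤ (b - a) / a := by
      rw [← Real.log_div hb0.ne' ha0.ne']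
      have := Real.log_le_sub_one_of_pos (x := b / a) (by positivity)
      rwa [div_sub_one ha0.ne'] at this
    have h3 : (b - a) / a - (b - a) / b ≤ a⁻¹ - b⁻¹ := by
      have : (b - a) / a - (b - a) / b = (b - a) * (a⁻¹ - b⁻¹) := by ring
      rw [this]
      exact mul_le_of_le_one_left hinv hba
    rw [hkey]
    calc _ ≤ |(b - a) / b - (Real.log b - Real.log a)| + |R n * (a⁻¹ - b⁻¹)| := abs_add_le _ _
      _ ≤ (a⁻¹ - b⁻¹) + C * (a⁻¹ - b⁻¹) := by
        refine add_le_add ?_ ?_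
        · rw [abs_le]; constructor <;> linarith
        · rw [abs_mul, abs_of_nonneg hinv]
          exact mul_le_mul_of_nonneg_right (hC n (by omega)) hinv
      _ = _ := by ring
  have hind (n : ℕ) (hn : 2 ≤ n) :
      |F n - F 2| ≤ (C + 1) * ((Real.log 2)⁻¹ - (Real.log n)⁻¹) := by
    induction n, hn using Nat.le_induction with
    | base => simp
    | succ n hn ih =>
      calc |F (n + 1) - F 2| ≤ |F (n + 1) - F n| + |F n - F 2| := abs_sub_le _ _ _
        _ ≤ _ := add_le_add (hstep n hn) ih
        _ = _ := by ring
  refine ⟨|F 2| + (C + 1) * (Real.log 2)⁻¹ + C * (Real.log 2)⁻¹, fun n hn => ?_⟩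
  have hln : Real.log 2 ≤ Real.log n :=
    Real.log_le_log (by norm_num) (by exact_mod_cast hn)
  have h1 : |R n / Real.log n| ≤ C * (Real.log 2)⁻¹ := by
    rw [abs_div, abs_of_pos (hl2.trans_le hln), div_eq_mul_inv]
    exact mul_le_mul (hC n (by omega)) (inv_anti₀ hl2 hln)
      (inv_nonneg.2 (hl2.le.trans hln)) hC0
  have h2 : |F n - F 2| ≤ (C + 1) * (Real.log 2)⁻¹ := by
    refine (hind n hn).trans (mul_le_mul_of_nonneg_left ?_ (by linarith))
    have : 0 ≤ (Real.log n)⁻¹ := inv_nonneg.2 (hl2.le.trans hln)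
    linarith
  have h3 : ∑ p ∈ n.primesLE, (p : ℝ)⁻¹ - Real.log (Real.log n) =
      F 2 + (F n - F 2) + R n / Real.log n := by simp only [hF]; ring
  rw [h3]
  exact (abs_add_le _ _).trans (add_le_add ((abs_add_le _ _).trans (by gcongr)) h1)

/-- Mertens' second theorem for a real cutoff. -/
theorem exists_abs_sum_inv_prime_floor_sub_loglog_le :
    ∃ C : ℝ, ∀ x : ℝ, 2 ≤ x →
      |∑ p ∈ ⌊x⌋₊.primesLE, (p : ℝ)⁻¹ - Real.log (Real.log x)| ≤ C := by
  obtain ⟨C, hC⟩ := exists_abs_sum_inv_prime_sub_loglog_le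
  refine ⟨C + Real.log 2, fun x hx => ?_⟩
  have hm : 2 ≤ ⌊x⌋₊ := Nat.le_floor (by exact_mod_cast hx)
  set m := ⌊x⌋₊
  have hm2 : (2 : ℝ) ≤ m := by exact_mod_cast hm
  have hmx : (m : ℝ) ≤ x := Nat.floor_le (by linarith)
  have hxm : x < m + 1 := Nat.lt_floor_add_one x
  have hlm : 0 < Real.log m := Real.log_pos (by linarith)
  have h1 : Real.log (Real.log m) ≤ Real.log (Real.log x) :=
    Real.log_le_log hlm (Real.log_le_log (by linarith) hmx)
  have h2 : Real.log (Real.log x) ≤ Real.log 2 + Real.log (Real.log m) := by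
    rw [← Real.log_mul (by norm_num) hlm.ne']
    refine Real.log_le_log (Real.log_pos (by linarith)) ?_
    have : Real.log x ≤ Real.log ((m : ℝ) ^ 2) := Real.log_le_log (by linarith) (by nlinarith)
    rwa [Real.log_pow] at this
  have h3 := abs_le.1 (hC m hm)
  rw [abs_le]
  constructor <;> linarith

/-- A sieve estimate for the average over `i ≤ n` of the multiplicative weight
`(1 + w) ^ #{p ∈ S : p ∣ i}`, with error term controlled as in the method of Rankin. -/
theorem norm_sum_pow_card_dvd_div_sub_prod_le {S : Finset ℕ} (hS : ∀ p ∈ S, p.Prime)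
    {n : ℕ} (hn : 0 < n) {ε K : ℝ} (hε0 : 0 ≤ ε) (hε1 : ε ≤ 1)
    (hK : ∀ p ∈ S, (p : ℝ) ^ ε ≤ K) (w : ℂ) :
    ‖(∑ i ∈ Finset.Ioc 0 n, (1 + w) ^ (S.filter (· ∣ i)).card) / n - ∏ p ∈ S, (1 + w / p)‖ ≤
      (n : ℝ) ^ (-ε) * Real.exp (K * ‖w‖ * ∑ p ∈ S, (p : ℝ)⁻¹) := by
  have hn0 : (0 : ℝ) < n := by exact_mod_cast hn
  have hexp (i : ℕ) : (1 + w) ^ (S.filter (· ∣ i)).card =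
      ∑ T ∈ S.powerset, if ∏ p ∈ T, p ∣ i then w ^ T.card else 0 := by
    rw [← Finset.prod_const, Finset.prod_filter]
    have : ∀ p ∈ S, (if p ∣ i then 1 + w else 1) = 1 + if p ∣ i then w else 0 := by
      intro p _
      split_ifs <;> simp
    rw [Finset.prod_congr rfl this, Finset.prod_one_add]
    refine Finset.sum_congr rfl fun T hT => ?_
    have hT' := Finset.mem_powerset.1 hT
    split_ifs with h
    · rw [← Finset.prod_const]
      exact Finset.prod_congr rfl fun p hp => if_pos ((Finset.dvd_prod_of_mem _ hp).trans h)
    · obtain ⟨p, hp, hpi⟩ : ∃ p ∈ T, ¬ p ∣ i := by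
        by_contra! hcon
        exact h (Finset.prod_primes_dvd _ (fun p hp => (hS p (hT' hp)).prime) hcon)
      exact Finset.prod_eq_zero hp (if_neg hpi)
  have hsum : ∑ i ∈ Finset.Ioc 0 n, (1 + w) ^ (S.filter (· ∣ i)).card =
      ∑ T ∈ S.powerset, w ^ T.card * ((n / ∏ p ∈ T, p : ℕ) : ℂ) := by
    simp_rw [hexp]
    rw [Finset.sum_comm]
    refine Finset.sum_congr rfl fun T _ => ?_
    rw [← Finset.sum_filter, Finset.sum_const, Nat.Ioc_filter_dvd_card_eq_div, nsmul_eq_mul,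
      mul_comm]
  have hprod : ∏ p ∈ S, (1 + w / p) = ∑ T ∈ S.powerset, w ^ T.card * ((∏ p ∈ T, p : ℕ) : ℂ)⁻¹ := by
    rw [Finset.prod_one_add]
    refine Finset.sum_congr rfl fun T _ => ?_
    rw [Finset.prod_div_distrib, Finset.prod_const, Nat.cast_prod, div_eq_mul_inv]
  have hround (d : ℕ) (hd : 0 < d) :
      |((n / d : ℕ) : ℝ) / n - (d : ℝ)⁻¹| ≤ (n : ℝ) ^ (-ε) * ((d : ℝ) ^ ε * (d : ℝ)⁻¹) := by
    have hd0 : (0 : ℝ) < d := by exact_mod_cast hd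
    have hup : ((n / d : ℕ) : ℝ) ≤ n / d := Nat.cast_div_le
    have hlo : (n : ℝ) / d - 1 ≤ (n / d : ℕ) := by
      rw [← Nat.floor_div_eq_div (K := ℝ)]
      exact (Nat.sub_one_lt_floor _).le
    have habs : |((n / d : ℕ) : ℝ) / n - (d : ℝ)⁻¹| = (d : ℝ)⁻¹ - ((n / d : ℕ) : ℝ) / n := by
      rw [abs_sub_comm, abs_of_nonneg]
      rw [sub_nonneg, div_le_iff₀ hn0, inv_mul_eq_div]
      exact hup
    rw [habs]
    rcases le_total (n : ℝ) d with h | h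
    · have h1 : 1 ≤ (n : ℝ) ^ (-ε) * (d : ℝ) ^ ε := by
        rw [Real.rpow_neg hn0.le, inv_mul_eq_div, one_le_div (by positivity)]
        exact Real.rpow_le_rpow hn0.le h hε0
      have h2 : 0 ≤ ((n / d : ℕ) : ℝ) / n := by positivity
      have h3 : (d : ℝ)⁻¹ ≤ (n : ℝ) ^ (-ε) * (d : ℝ) ^ ε * (d : ℝ)⁻¹ :=
        le_mul_of_one_le_left (by positivity) h1
      linarith
    · have h1 : (d : ℝ)⁻¹ - ((n / d : ℕ) : ℝ) / n ≤ (n : ℝ)⁻¹ := by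
        have : ((n : ℝ) / d - 1) / n ≤ ((n / d : ℕ) : ℝ) / n := by gcongr
        have h2 : ((n : ℝ) / d - 1) / n = (d : ℝ)⁻¹ - (n : ℝ)⁻¹ := by field_simp
        linarith
      refine h1.trans ?_
      have h4 : (n : ℝ) ^ (-ε) * ((d : ℝ) ^ ε * (d : ℝ)⁻¹) =
          (n : ℝ) ^ (-ε) * (d : ℝ) ^ (ε - 1) := by
        rw [Real.rpow_sub_one hd0.ne', div_eq_mul_inv]
      have h5 : (n : ℝ)⁻¹ = (n : ℝ) ^ (-ε) * (n : ℝ) ^ (ε - 1) := by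
        rw [← Real.rpow_add hn0, ← Real.rpow_neg_one]
        ring_nf
      rw [h4, h5]
      exact mul_le_mul_of_nonneg_left
        (Real.rpow_le_rpow_of_nonpos hd0 h (by linarith)) (by positivity)
  rw [hsum, hprod, Finset.sum_div, ← Finset.sum_sub_distrib]
  have hmain : ∏ p ∈ S, (1 + K * ‖w‖ * (p : ℝ)⁻¹) ≤
      Real.exp (K * ‖w‖ * ∑ p ∈ S, (p : ℝ)⁻¹) := by
    rw [Finset.mul_sum, Real.exp_sum]
    refine Finset.prod_le_prod (fun p hp => ?_) fun p _ => ?_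
    · have : 0 ≤ K := (by positivity : (0 : ℝ) ≤ (p : ℝ) ^ ε).trans (hK p hp)
      positivity
    · rw [add_comm]
      exact Real.add_one_le_exp _
  refine le_trans ?_ (mul_le_mul_of_nonneg_left hmain (by positivity))
  rw [Finset.prod_one_add, Finset.mul_sum]
  refine (norm_sum_le _ _).trans (Finset.sum_le_sum fun T hT => ?_)
  have hT' := Finset.mem_powerset.1 hT
  have hd : 0 < ∏ p ∈ T, p := Finset.prod_pos fun p hp => (hS p (hT' hp)).pos
  have hcast : w ^ T.card * ((n / ∏ p ∈ T, p : ℕ) : ℂ) / n - w ^ T.card * ((∏ p ∈ T, p : ℕ) : ℂ)⁻¹ =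
      w ^ T.card * ((((n / ∏ p ∈ T, p : ℕ) : ℝ) / n - ((∏ p ∈ T, p : ℕ) : ℝ)⁻¹ : ℝ) : ℂ) := by
    push_cast
    ring
  rw [hcast, norm_mul, norm_pow, Complex.norm_real, Real.norm_eq_abs]
  have hpow : ((∏ p ∈ T, p : ℕ) : ℝ) ^ ε ≤ K ^ T.card := by
    rw [Nat.cast_prod, ← Real.finsetProd_rpow _ _ (fun _ _ => by positivity), ← Finset.prod_const]
    exact Finset.prod_le_prod (fun _ _ => by positivity) fun p hp => hK p (hT' hp)
  calc ‖w‖ ^ T.card * |((n / ∏ p ∈ T, p : ℕ) : ℝ) / n - ((∏ p ∈ T, p : ℕ) : ℝ)⁻¹|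
      ≤ ‖w‖ ^ T.card * ((n : ℝ) ^ (-ε) * (K ^ T.card * ((∏ p ∈ T, p : ℕ) : ℝ)⁻¹)) := by
        refine mul_le_mul_of_nonneg_left ((hround _ hd).trans ?_) (by positivity)
        gcongr
    _ = _ := by
        rw [Finset.prod_mul_distrib, Finset.prod_const, mul_pow, Finset.prod_inv_distrib,
          Nat.cast_prod]
        ring

/-- Large primes contribute little to the average of `exp (i θ ω)`. -/
theorem norm_sum_exp_card_primeFactors_sub_le {n z : ℕ} (hz : z ≤ n) (θ : ℝ) :
    ‖∑ i ∈ Finset.Ioc 0 n, Complex.exp (θ * Complex.I) ^ i.primeFactors.card -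
        ∑ i ∈ Finset.Ioc 0 n,
          Complex.exp (θ * Complex.I) ^ (z.primesLE.filter (· ∣ i)).card‖ ≤
      n * (|θ| * (∑ p ∈ n.primesLE, (p : ℝ)⁻¹ - ∑ p ∈ z.primesLE, (p : ℝ)⁻¹)) := by
  have hsub : z.primesLE ⊆ n.primesLE := Nat.primesLE_mono hz
  have hpt (i : ℕ) (hi : i ∈ Finset.Ioc 0 n) :
      ‖Complex.exp (θ * Complex.I) ^ i.primeFactors.card -
        Complex.exp (θ * Complex.I) ^ (z.primesLE.filter (· ∣ i)).card‖ ≤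
      |θ| * ((n.primesLE \ z.primesLE).filter (· ∣ i)).card := by
    rw [Finset.mem_Ioc] at hi
    have hcard : i.primeFactors.card = (z.primesLE.filter (· ∣ i)).card +
        ((n.primesLE \ z.primesLE).filter (· ∣ i)).card := by
      rw [← Finset.card_union_of_disjoint
        (Finset.disjoint_filter_filter Finset.disjoint_sdiff), ← Finset.filter_union,
        Finset.union_sdiff_of_subset hsub]
      congr 1
      ext p
      simp only [Nat.mem_primeFactors, Finset.mem_filter, Nat.mem_primesLE]
      constructor
      · rintro ⟨hp, hd, -⟩
        exact ⟨⟨(Nat.le_of_dvd hi.1 hd).trans hi.2, hp⟩, hd⟩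
      · rintro ⟨⟨-, hp⟩, hd⟩
        exact ⟨hp, hd, by omega⟩
    set k := ((n.primesLE \ z.primesLE).filter (· ∣ i)).card
    rw [hcard, pow_add, ← mul_sub_one, norm_mul, norm_pow, Complex.norm_exp_ofReal_mul_I,
      one_pow, one_mul, ← Complex.exp_nat_mul, mul_comm |θ|]
    have := norm_exp_I_mul_ofReal_sub_one_le (x := k * θ)
    rw [Real.norm_eq_abs, abs_mul, Nat.abs_cast] at this
    convert this using 3
    push_cast
    ring_nf
  rw [← Finset.sum_sub_distrib, ← Finset.sum_sdiff_eq_sub hsub]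
  refine (norm_sum_le _ _).trans ((Finset.sum_le_sum hpt).trans ?_)
  rw [← Finset.mul_sum, mul_left_comm]
  refine mul_le_mul_of_nonneg_left ?_ (abs_nonneg _)
  simp_rw [Finset.card_filter]
  push_cast
  rw [Finset.sum_comm, Finset.mul_sum]
  refine Finset.sum_le_sum fun p _ => ?_
  rw [← Finset.sum_filter, Finset.sum_const, Nat.Ioc_filter_dvd_card_eq_div, nsmul_eq_mul,
    mul_one, ← div_eq_mul_inv]
  exact Nat.cast_div_le

/-- The Euler-type product is approximated by the exponential of its linear term. -/
theorem exists_prod_one_add_div_prime_eq_exp :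
    ∃ C : ℝ, ∀ (S : Finset ℕ) (w : ℂ), (∀ p ∈ S, 1 ≤ p) → ‖w‖ ≤ 1 / 2 →
      ∃ E : ℂ, ‖E‖ ≤ C * ‖w‖ ^ 2 ∧
        ∏ p ∈ S, (1 + w / p) = Complex.exp (w * ((∑ p ∈ S, (p : ℝ)⁻¹ : ℝ) : ℂ) + E) := by
  have hsum : Summable fun m : ℕ => ((m : ℝ) ^ 2)⁻¹ :=
    Real.summable_nat_pow_inv.2 one_lt_two
  refine ⟨∑' m : ℕ, ((m : ℝ) ^ 2)⁻¹, fun S w hS hw => ?_⟩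
  refine ⟨∑ p ∈ S, (Complex.log (1 + w / p) - w / p), ?_, ?_⟩
  · calc ‖∑ p ∈ S, (Complex.log (1 + w / p) - w / p)‖
        ≤ ∑ p ∈ S, ((p : ℝ) ^ 2)⁻¹ * ‖w‖ ^ 2 := by
          refine norm_sum_le_of_le _ fun p hp => ?_
          have hp1 : (1 : ℝ) ≤ p := by exact_mod_cast hS p hp
          have hle : ‖w / p‖ ≤ 1 / 2 := by
            rw [norm_div, Complex.norm_natCast]
            exact (div_le_self (norm_nonneg _) hp1).trans hw
          refine (Complex.norm_log_one_add_sub_self_le (by linarith)).trans ?_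
          have h1 : (1 - ‖w / p‖)⁻¹ ≤ 2 := by
            rw [inv_le_comm₀ (by linarith) (by norm_num)]
            linarith
          calc ‖w / p‖ ^ 2 * (1 - ‖w / p‖)⁻¹ / 2 ≤ ‖w / p‖ ^ 2 * 2 / 2 := by gcongr
            _ = _ := by rw [norm_div, Complex.norm_natCast]; ring
      _ ≤ _ := by
          rw [← Finset.sum_mul]
          exact mul_le_mul_of_nonneg_right
            (hsum.sum_le_tsum _ fun _ _ => by positivity) (by positivity)
  · have : w * ((∑ p ∈ S, (p : ℝ)⁻¹ : ℝ) : ℂ) + ∑ p ∈ S, (Complex.log (1 + w / p) - w / p) =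
        ∑ p ∈ S, Complex.log (1 + w / p) := by
      rw [Finset.sum_sub_distrib]
      push_cast
      rw [Finset.mul_sum]
      simp [div_eq_mul_inv]
    rw [this, Complex.exp_sum]
    refine Finset.prod_congr rfl fun p hp => ?_
    rw [Complex.exp_log]
    intro h0
    have hp1 : (1 : ℝ) ≤ p := by exact_mod_cast hS p hp
    have hle : ‖w / p‖ ≤ 1 / 2 := by
      rw [norm_div, Complex.norm_natCast]
      exact (div_le_self (norm_nonneg _) hp1).trans hw
    rw [show w / p = -1 by linear_combination h0] at hle
    norm_num at hle

theorem tendsto_loglog_natCast_atTop :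
    Tendsto (fun n : ℕ => Real.log (Real.log n)) atTop atTop :=
  Real.tendsto_log_atTop.comp (Real.tendsto_log_atTop.comp tendsto_natCast_atTop_atTop)

/-- The cutoff `exp (log n / log log n)` separating small primes from large primes. -/
noncomputable def smallPrimeCutoff (n : ℕ) : ℕ :=
  ⌊Real.exp (Real.log n / Real.log (Real.log n))⌋₊

theorem eventually_smallPrimeCutoff_le : ∀ᶠ n : ℕ in atTop, smallPrimeCutoff n ≤ n := by
  filter_upwards [tendsto_loglog_natCast_atTop.eventually_ge_atTop 1, eventually_ge_atTop 1]
    with n hL hn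
  refine Nat.floor_le_of_le ?_
  conv_rhs => rw [← Real.exp_log (show (0 : ℝ) < n by exact_mod_cast hn)]
  exact Real.exp_le_exp.2 (div_le_self (Real.log_natCast_nonneg n) hL)

theorem tendsto_const_add_log_div_sqrt (C : ℝ) :
    Tendsto (fun x : ℝ => (C + Real.log x) / √x) atTop (nhds 0) := by
  have h1 : Tendsto (fun x : ℝ => C / √x) atTop (nhds 0) :=
    Real.tendsto_sqrt_atTop.const_div_atTop C
  have h2 : Tendsto (fun x : ℝ => Real.log x / √x) atTop (nhds 0) := by
    simp_rw [Real.sqrt_eq_rpow]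
    exact (isLittleO_log_rpow_atTop (by norm_num)).tendsto_div_nhds_zero
  simpa [add_div] using h1.add h2

theorem exists_abs_sum_inv_prime_smallPrimeCutoff_sub_le :
    ∃ C : ℝ, ∀ᶠ n : ℕ in atTop,
      |∑ p ∈ (smallPrimeCutoff n).primesLE, (p : ℝ)⁻¹ - Real.log (Real.log n)| ≤
        C + Real.log (Real.log (Real.log n)) := by
  obtain ⟨C, hC⟩ := exists_abs_sum_inv_prime_floor_sub_loglog_le
  refine ⟨C, ?_⟩
  have h1 : Tendsto (fun n : ℕ => Real.log n / Real.log (Real.log n)) atTop atTop := by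
    have h : Tendsto (fun x : ℝ => x / Real.log x) atTop atTop := by
      have h2 := Real.isLittleO_log_id_atTop.tendsto_div_nhds_zero
      have h3 : Tendsto (fun x : ℝ => Real.log x / x) atTop (nhdsWithin 0 (Set.Ioi 0)) := by
        refine tendsto_nhdsWithin_iff.2 ⟨h2, ?_⟩
        filter_upwards [eventually_gt_atTop 1] with x hx
        exact div_pos (Real.log_pos hx) (by linarith)
      refine h3.inv_tendsto_nhdsGT_zero.congr fun x => ?_
      simp
    exact h.comp (Real.tendsto_log_atTop.comp tendsto_natCast_atTop_atTop)
  filter_upwards [h1.eventually_ge_atTop 1, tendsto_loglog_natCast_atTop.eventually_ge_atTop 1]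
    with n hn hL
  have hlog : 0 < Real.log n := by
    by_contra! h
    have := le_antisymm h (Real.log_natCast_nonneg n)
    rw [this] at hL
    norm_num at hL
  have h2 := hC (Real.exp (Real.log n / Real.log (Real.log n)))
    (by linarith [Real.add_one_le_exp (Real.log n / Real.log (Real.log n))])
  rw [Real.log_exp, Real.log_div hlog.ne' (by linarith)] at h2
  have h3 := Real.log_nonneg hL
  have h4 := abs_le.1 h2
  rw [smallPrimeCutoff, abs_le]
  constructor <;> linarith

theorem tendsto_sum_inv_smallPrime_sub_loglog_div_sqrt :
    Tendsto (fun n : ℕ => (∑ p ∈ (smallPrimeCutoff n).primesLE, (p : ℝ)⁻¹ -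
      Real.log (Real.log n)) / √(Real.log (Real.log n))) atTop (nhds 0) := by
  obtain ⟨C, hC⟩ := exists_abs_sum_inv_prime_smallPrimeCutoff_sub_le
  refine squeeze_zero_norm' ?_
    ((tendsto_const_add_log_div_sqrt C).comp tendsto_loglog_natCast_atTop)
  filter_upwards [hC] with n hn
  rw [norm_div, Real.norm_eq_abs, Real.norm_of_nonneg (Real.sqrt_nonneg _)]
  exact div_le_div_of_nonneg_right hn (Real.sqrt_nonneg _)

theorem tendsto_sum_inv_largePrime_div_sqrt :
    Tendsto (fun n : ℕ => (∑ p ∈ n.primesLE, (p : ℝ)⁻¹ -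
      ∑ p ∈ (smallPrimeCutoff n).primesLE, (p : ℝ)⁻¹) / √(Real.log (Real.log n)))
      atTop (nhds 0) := by
  obtain ⟨C, hC⟩ := exists_abs_sum_inv_prime_sub_loglog_le
  have h : Tendsto (fun n : ℕ => (∑ p ∈ n.primesLE, (p : ℝ)⁻¹ -
      Real.log (Real.log n)) / √(Real.log (Real.log n))) atTop (nhds 0) := by
    refine squeeze_zero_norm' ?_
      ((Real.tendsto_sqrt_atTop.comp tendsto_loglog_natCast_atTop).const_div_atTop C)
    filter_upwards [eventually_ge_atTop 2] with n hn
    rw [norm_div, Real.norm_eq_abs, Real.norm_of_nonneg (Real.sqrt_nonneg _)]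
    exact div_le_div_of_nonneg_right (hC n hn) (Real.sqrt_nonneg _)
  have h2 := h.sub tendsto_sum_inv_smallPrime_sub_loglog_div_sqrt
  rw [sub_zero] at h2
  exact h2.congr fun n => by ring

theorem tendsto_sum_inv_smallPrime_div_loglog :
    Tendsto (fun n : ℕ => (∑ p ∈ (smallPrimeCutoff n).primesLE, (p : ℝ)⁻¹) /
      Real.log (Real.log n)) atTop (nhds 1) := by
  have h := (tendsto_sum_inv_smallPrime_sub_loglog_div_sqrt.div_atTop
    (Real.tendsto_sqrt_atTop.comp tendsto_loglog_natCast_atTop)).add_const 1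
  rw [zero_add] at h
  refine h.congr' ?_
  filter_upwards [tendsto_loglog_natCast_atTop.eventually_gt_atTop 0] with n hn
  rw [Function.comp_apply, div_div, Real.mul_self_sqrt hn.le]
  field_simp
  ring

theorem tendsto_div_sqrt_loglog (t : ℝ) :
    Tendsto (fun n : ℕ => t / √(Real.log (Real.log n))) atTop (nhds 0) :=
  (Real.tendsto_sqrt_atTop.comp tendsto_loglog_natCast_atTop).const_div_atTop t

theorem norm_exp_ofReal_mul_I_sub_one_le_abs (θ : ℝ) :
    ‖Complex.exp (θ * Complex.I) - 1‖ ≤ |θ| := by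
  rw [mul_comm]
  exact norm_exp_I_mul_ofReal_sub_one_le

/-- The average of `exp (i θ ω)` agrees asymptotically with its small prime part. -/
theorem tendsto_sum_exp_card_primeFactors_sub (t : ℝ) :
    Tendsto (fun n : ℕ =>
      (∑ i ∈ Finset.Ioc 0 n,
        Complex.exp ((t / √(Real.log (Real.log n)) : ℝ) * Complex.I) ^ i.primeFactors.card) / n -
      (∑ i ∈ Finset.Ioc 0 n,
        Complex.exp ((t / √(Real.log (Real.log n)) : ℝ) * Complex.I) ^
          ((smallPrimeCutoff n).primesLE.filter (· ∣ i)).card) / n) atTop (nhds 0) := by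
  have h := tendsto_sum_inv_largePrime_div_sqrt.const_mul |t|
  rw [mul_zero] at h
  refine squeeze_zero_norm' ?_ h
  filter_upwards [eventually_smallPrimeCutoff_le, eventually_gt_atTop 0] with n hz hn
  rw [← sub_div, norm_div, Complex.norm_natCast, div_le_iff₀ (by exact_mod_cast hn)]
  refine (norm_sum_exp_card_primeFactors_sub_le hz _).trans_eq ?_
  rw [abs_div, abs_of_nonneg (Real.sqrt_nonneg _)]
  ring

/-- The small prime part is asymptotically an Euler product. -/
theorem tendsto_sum_exp_card_smallPrime_sub_prod (t : ℝ) :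
    Tendsto (fun n : ℕ =>
      (∑ i ∈ Finset.Ioc 0 n,
        Complex.exp ((t / √(Real.log (Real.log n)) : ℝ) * Complex.I) ^
          ((smallPrimeCutoff n).primesLE.filter (· ∣ i)).card) / n -
      ∏ p ∈ (smallPrimeCutoff n).primesLE,
        (1 + (Complex.exp ((t / √(Real.log (Real.log n)) : ℝ) * Complex.I) - 1) / p))
      atTop (nhds 0) := by
  have hexp : Tendsto (fun n : ℕ => Real.exp (Real.log (Real.log n) *
      (-1 + Real.exp 1 * (|t| / √(Real.log (Real.log n))) *
        ((∑ p ∈ (smallPrimeCutoff n).primesLE, (p : ℝ)⁻¹) / Real.log (Real.log n)))))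
      atTop (nhds 0) := by
    refine Real.tendsto_exp_atBot.comp (tendsto_loglog_natCast_atTop.atTop_mul_neg
      (C := -1) (by norm_num) ?_)
    have := (((tendsto_div_sqrt_loglog |t|).const_mul (Real.exp 1)).mul
      tendsto_sum_inv_smallPrime_div_loglog).const_add (-1)
    simpa using this
  refine squeeze_zero_norm' ?_ hexp
  filter_upwards [tendsto_loglog_natCast_atTop.eventually_ge_atTop 1, eventually_gt_atTop 0]
    with n hL hn
  set L := Real.log (Real.log n) with hLdef
  have hn0 : (0 : ℝ) < n := by exact_mod_cast hn
  have hlog : 0 < Real.log n := by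
    by_contra! h
    have := le_antisymm h (Real.log_natCast_nonneg n)
    rw [hLdef, this] at hL
    norm_num at hL
  have hLle : L ≤ Real.log n := Real.log_le_self hlog.le
  have h := norm_sum_pow_card_dvd_div_sub_prod_le (S := (smallPrimeCutoff n).primesLE)
    (fun p hp => Nat.prime_of_mem_primesLE hp) hn (ε := L / Real.log n) (K := Real.exp 1)
    (by positivity) ((div_le_one hlog).2 hLle) ?_
    (Complex.exp ((t / √L : ℝ) * Complex.I) - 1)
  · rw [add_sub_cancel] at h
    refine h.trans ?_
    have h1 : (n : ℝ) ^ (-(L / Real.log n)) = Real.exp (-L) := by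
      rw [Real.rpow_def_of_pos hn0]
      congr 1
      field_simp
    rw [h1, ← Real.exp_add]
    refine Real.exp_le_exp.2 ?_
    have h2 := norm_exp_ofReal_mul_I_sub_one_le_abs (t / √L)
    rw [abs_div, abs_of_nonneg (Real.sqrt_nonneg _)] at h2
    calc _ ≤ -L + Real.exp 1 * (|t| / √L) *
          ∑ p ∈ (smallPrimeCutoff n).primesLE, (p : ℝ)⁻¹ := by gcongr
      _ = _ := by field_simp
  · intro p hp
    have hp0 : (0 : ℝ) < p := by exact_mod_cast (Nat.prime_of_mem_primesLE hp).pos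
    have hple : (p : ℝ) ≤ Real.exp (Real.log n / L) :=
      (Nat.le_floor_iff (Real.exp_pos _).le).1 (Nat.le_of_mem_primesLE hp)
    calc (p : ℝ) ^ (L / Real.log n) ≤ Real.exp (Real.log n / L) ^ (L / Real.log n) :=
          Real.rpow_le_rpow hp0.le hple (by positivity)
      _ = Real.exp 1 := by
          rw [← Real.exp_mul]
          congr 1
          field_simp

/-- The centred Euler product converges to the Gaussian characteristic function. -/
theorem tendsto_prod_mul_exp_neg (t : ℝ) :
    Tendsto (fun n : ℕ =>
      (∏ p ∈ (smallPrimeCutoff n).primesLE,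
        (1 + (Complex.exp ((t / √(Real.log (Real.log n)) : ℝ) * Complex.I) - 1) / p)) *
      Complex.exp (-((t / √(Real.log (Real.log n)) : ℝ) * Real.log (Real.log n) * Complex.I)))
      atTop (nhds (Complex.exp (-(t ^ 2 / 2)))) := by
  obtain ⟨C, hC⟩ := exists_prod_one_add_div_prime_eq_exp
  set L : ℕ → ℝ := fun n => Real.log (Real.log n) with hL
  set θ : ℕ → ℝ := fun n => t / √(L n) with hθ
  set P : ℕ → ℝ := fun n => ∑ p ∈ (smallPrimeCutoff n).primesLE, (p : ℝ)⁻¹ with hP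
  set w : ℕ → ℂ := fun n => Complex.exp (θ n * Complex.I) - 1 with hw
  have hθ0 : Tendsto θ atTop (nhds 0) := tendsto_div_sqrt_loglog t
  have hwθ (n : ℕ) : ‖w n‖ ≤ |θ n| := norm_exp_ofReal_mul_I_sub_one_le_abs _
  have hwhalf : ∀ᶠ n in atTop, ‖w n‖ ≤ 1 / 2 := by
    have : ∀ᶠ n in atTop, |θ n| < 1 / 2 := by
      have := hθ0.abs
      rw [abs_zero] at this
      exact this.eventually_lt_const (by norm_num)
    exact this.mono fun n hn => (hwθ n).trans hn.le
  have hθP : Tendsto (fun n => θ n ^ 2 * P n) atTop (nhds (t ^ 2)) := by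
    have := tendsto_sum_inv_smallPrime_div_loglog.const_mul (t ^ 2)
    rw [mul_one] at this
    refine this.congr' ?_
    filter_upwards [tendsto_loglog_natCast_atTop.eventually_gt_atTop 0] with n hn
    simp only [hθ, div_pow]
    rw [Real.sq_sqrt hn.le]
    ring
  have hθPL : Tendsto (fun n => θ n * (P n - L n)) atTop (nhds 0) := by
    have := tendsto_sum_inv_smallPrime_sub_loglog_div_sqrt.const_mul t
    rw [mul_zero] at this
    exact this.congr fun n => by simp only [hθ]; ring
  have hex (n : ℕ) : ∃ E : ℂ, ‖w n‖ ≤ 1 / 2 → ‖E‖ ≤ C * ‖w n‖ ^ 2 ∧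
      ∏ p ∈ (smallPrimeCutoff n).primesLE, (1 + w n / p) = Complex.exp (w n * (P n : ℂ) + E) := by
    by_cases h : ‖w n‖ ≤ 1 / 2
    · obtain ⟨E, hE⟩ := hC (smallPrimeCutoff n).primesLE (w n)
        (fun p hp => (Nat.prime_of_mem_primesLE hp).one_le) h
      exact ⟨E, fun _ => hE⟩
    · exact ⟨0, fun h' => absurd h' h⟩
  choose E hE using hex
  have hw0 : Tendsto (fun n => ‖w n‖) atTop (nhds 0) := by
    have := hθ0.abs
    rw [abs_zero] at this
    exact squeeze_zero (fun _ => norm_nonneg _) hwθ this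
  have hE0 : Tendsto E atTop (nhds 0) := by
    have := (hw0.pow 2).const_mul C
    rw [zero_pow two_ne_zero, mul_zero] at this
    refine squeeze_zero_norm' ?_ this
    filter_upwards [hwhalf] with n hn
    exact (hE n hn).1
  have hrem : Tendsto (fun n => (w n - θ n * Complex.I + (θ n : ℂ) ^ 2 / 2) * P n)
      atTop (nhds 0) := by
    have h0 := hθ0.abs.mul hθP
    rw [abs_zero, zero_mul] at h0
    refine squeeze_zero_norm' ?_ h0
    have : ∀ᶠ n in atTop, |θ n| ≤ 1 := by
      have := hθ0.abs
      rw [abs_zero] at this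
      exact (this.eventually_lt_const (by norm_num)).mono fun n hn => le_of_lt hn
    filter_upwards [this] with n hn
    have hPn : 0 ≤ P n := Finset.sum_nonneg fun _ _ => by positivity
    have hb := Complex.exp_bound (x := θ n * Complex.I) (by simpa using hn) (n := 3) (by norm_num)
    have he : Complex.exp (θ n * Complex.I) -
        ∑ m ∈ Finset.range 3, (θ n * Complex.I) ^ m / (m.factorial : ℂ) =
        w n - θ n * Complex.I + (θ n : ℂ) ^ 2 / 2 := by
      simp only [Finset.sum_range_succ, Finset.sum_range_zero, hw, mul_pow, Complex.I_sq]
      norm_num [Nat.factorial]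
      ring
    rw [he] at hb
    have hnorm : ‖(θ n : ℂ) * Complex.I‖ = |θ n| := by simp
    rw [hnorm] at hb
    have hb' : ‖w n - θ n * Complex.I + (θ n : ℂ) ^ 2 / 2‖ ≤ |θ n| ^ 3 := by
      refine hb.trans (mul_le_of_le_one_right (by positivity) ?_)
      norm_num [Nat.factorial]
    rw [norm_mul, Complex.norm_real, Real.norm_of_nonneg hPn]
    calc _ ≤ |θ n| ^ 3 * P n := by gcongr
      _ = |θ n| * (θ n ^ 2 * P n) := by rw [← sq_abs (θ n)]; ring
  have hexpo : Tendsto (fun n => w n * P n + E n - θ n * L n * Complex.I) atTop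
      (nhds (-((t : ℂ) ^ 2 / 2))) := by
    have h1 : Tendsto (fun n => ((θ n * (P n - L n) : ℝ) : ℂ) * Complex.I) atTop
        (nhds (((0 : ℝ) : ℂ) * Complex.I)) :=
      ((Complex.continuous_ofReal.tendsto _).comp hθPL).mul_const _
    have h2 : Tendsto (fun n => ((θ n ^ 2 * P n : ℝ) : ℂ) / 2) atTop
        (nhds (((t ^ 2 : ℝ) : ℂ) / 2)) :=
      ((Complex.continuous_ofReal.tendsto _).comp hθP).div_const _
    have h3 := ((hrem.add h1).sub h2).add hE0
    have h4 : (0 : ℂ) + ((0 : ℝ) : ℂ) * Complex.I - ((t ^ 2 : ℝ) : ℂ) / 2 + 0 =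
        -((t : ℂ) ^ 2 / 2) := by
      push_cast
      ring
    rw [h4] at h3
    refine h3.congr fun n => ?_
    push_cast
    ring
  refine ((Complex.continuous_exp.tendsto _).comp hexpo).congr' ?_
  filter_upwards [hwhalf] with n hn
  rw [Function.comp_apply, (hE n hn).2, ← Complex.exp_add, sub_eq_add_neg]

theorem tendsto_sum_exp_card_primeFactors (t : ℝ) :
    Tendsto (fun n : ℕ =>
      (∑ i ∈ Finset.Ioc 0 n,
        Complex.exp ((t / √(Real.log (Real.log n)) : ℝ) * Complex.I) ^ i.primeFactors.card) / n *
      Complex.exp (-((t / √(Real.log (Real.log n)) : ℝ) * Real.log (Real.log n) * Complex.I)))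
      atTop (nhds (Complex.exp (-(t ^ 2 / 2)))) := by
  have h := (tendsto_sum_exp_card_primeFactors_sub t).add
    (tendsto_sum_exp_card_smallPrime_sub_prod t)
  rw [add_zero] at h
  have h0 := h.zero_mul_isBoundedUnder_le (g := fun n : ℕ =>
      Complex.exp (-((t / √(Real.log (Real.log n)) : ℝ) * Real.log (Real.log n) * Complex.I))) <|
    isBoundedUnder_of ⟨1, fun n => by
      rw [Function.comp_apply, ← Complex.ofReal_mul, ← neg_mul, ← Complex.ofReal_neg,
        Complex.norm_exp_ofReal_mul_I]⟩
  have h1 := h0.add (tendsto_prod_mul_exp_neg t)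
  rw [zero_add] at h1
  exact h1.congr fun n => by ring

/-- Lévy's theorem for the distribution functions of triangular arrays of finite samples. -/
theorem tendsto_card_filter_le_div_of_tendsto_sum_exp (x : ℕ → ℕ → ℝ)
    (hx : ∀ t : ℝ, Tendsto
      (fun n : ℕ => (∑ i ∈ Finset.Ioc 0 n, Complex.exp (t * x n i * Complex.I)) / n)
      atTop (nhds (Complex.exp (-(t ^ 2 / 2))))) (y : ℝ) :
    Tendsto (fun n : ℕ => (((Finset.Ioc 0 n).filter fun i => x n i ≤ y).card : ℝ) / n) atTop
      (nhds ((ProbabilityTheory.gaussianReal 0 1).real (Set.Iic y))) := by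
  rw [← tendsto_add_atTop_iff_nat 1]
  let ν : ℕ → MeasureTheory.Measure ℝ := fun n =>
    ((n : ENNReal))⁻¹ • ∑ i ∈ Finset.Ioc 0 n, MeasureTheory.Measure.dirac (x n i)
  have hνapply (n : ℕ) {s : Set ℝ} (hs : MeasurableSet s) [DecidablePred (· ∈ s)] :
      ν n s = (n : ENNReal)⁻¹ * ((Finset.Ioc 0 n).filter fun i => x n i ∈ s).card := by
    simp only [ν, MeasureTheory.Measure.smul_apply, MeasureTheory.Measure.finsetSum_apply,
      smul_eq_mul, MeasureTheory.Measure.dirac_apply' _ hs, Finset.card_filter]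
    simp [Set.indicator_apply]
  have hνprob (n : ℕ) : MeasureTheory.IsProbabilityMeasure (ν (n + 1)) := by
    classical
    refine ⟨?_⟩
    rw [hνapply _ MeasurableSet.univ]
    simp only [Set.mem_univ, Finset.filter_true, Nat.card_Ioc, tsub_zero]
    exact ENNReal.inv_mul_cancel (by simp) (by simp)
  let μ : ℕ → MeasureTheory.ProbabilityMeasure ℝ := fun n => ⟨ν (n + 1), hνprob n⟩
  let γ : MeasureTheory.ProbabilityMeasure ℝ := ⟨ProbabilityTheory.gaussianReal 0 1, inferInstance⟩
  have hlim : Tendsto μ atTop (nhds γ) := by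
    refine MeasureTheory.ProbabilityMeasure.tendsto_of_tendsto_charFun fun t => ?_
    have h1 : MeasureTheory.charFun (γ : MeasureTheory.Measure ℝ) t =
        Complex.exp (-(t ^ 2 / 2)) := by
      change MeasureTheory.charFun (ProbabilityTheory.gaussianReal 0 1) t = _
      rw [ProbabilityTheory.charFun_gaussianReal]
      simp
    rw [h1]
    refine ((tendsto_add_atTop_iff_nat 1).2 (hx t)).congr fun n => ?_
    change _ = MeasureTheory.charFun (ν (n + 1)) t
    rw [MeasureTheory.charFun_apply_real]
    simp only [ν]
    rw [MeasureTheory.integral_smul_measure, MeasureTheory.integral_finsetSum_measure]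
    · simp_rw [MeasureTheory.integral_dirac]
      rw [ENNReal.toReal_inv, ENNReal.toReal_natCast, Complex.real_smul, Complex.ofReal_inv,
        Complex.ofReal_natCast, inv_mul_eq_div]
    · exact fun i _ => MeasureTheory.integrable_dirac (by simp)
  have hfr : (γ : MeasureTheory.Measure ℝ) (frontier (Set.Iic y)) = 0 := by
    change ProbabilityTheory.gaussianReal 0 1 (frontier (Set.Iic y)) = 0
    have := ProbabilityTheory.nullSingletonClass_gaussianReal (μ := 0) (v := 1) one_ne_zero
    rw [frontier_Iic]
    exact MeasureTheory.measure_singleton y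
  have h := (ENNReal.tendsto_toReal (MeasureTheory.measure_ne_top _ _)).comp
    (MeasureTheory.ProbabilityMeasure.tendsto_measure_of_null_frontier_of_tendsto' hlim hfr)
  refine h.congr fun n => ?_
  change (ν (n + 1) (Set.Iic y)).toReal = _
  rw [hνapply _ measurableSet_Iic, ENNReal.toReal_mul, ENNReal.toReal_inv, ENNReal.toReal_natCast,
    ENNReal.toReal_natCast, inv_mul_eq_div]
  simp only [Set.mem_Iic]

theorem gaussianReal_real_Iic (y : ℝ) :
    (ProbabilityTheory.gaussianReal 0 1).real (Set.Iic y) =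
      (1 / Real.sqrt (2 * π)) * ∫ t in Set.Iic y, Real.exp (-t ^ 2 / 2) := by
  rw [MeasureTheory.measureReal_def,
    ProbabilityTheory.gaussianReal_apply_eq_integral _ one_ne_zero,
    ENNReal.toReal_ofReal
      (MeasureTheory.integral_nonneg (ProbabilityTheory.gaussianPDFReal_nonneg 0 1)),
    ← MeasureTheory.integral_const_mul]
  simp [ProbabilityTheory.gaussianPDFReal]

theorem erdos_kac (y : ℝ) :
    Tendsto (fun n : ℕ =>
      (((Finset.Icc 3 n).filter (fun i =>
          (i.primeFactors.card : ℝ) - Real.log (Real.log n) ≤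
            y * Real.sqrt (Real.log (Real.log n)))).card : ℝ) / n)
      atTop (nhds ((1 / Real.sqrt (2 * π)) * ∫ t in Set.Iic y, Real.exp (-t ^ 2 / 2))) := by
  have h := tendsto_card_filter_le_div_of_tendsto_sum_exp
    (fun n i => ((i.primeFactors.card : ℝ) - Real.log (Real.log n)) / √(Real.log (Real.log n)))
    (fun t => (tendsto_sum_exp_card_primeFactors t).congr fun n => by
      rw [div_mul_eq_mul_div, Finset.sum_mul]
      congr 1
      refine Finset.sum_congr rfl fun i _ => ?_
      rw [← Complex.exp_nat_mul, ← Complex.exp_add]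
      congr 1
      push_cast
      ring) y
  rw [gaussianReal_real_Iic] at h
  have hsmall : Tendsto (fun n : ℕ => (2 : ℝ) / n) atTop (nhds 0) :=
    tendsto_const_div_atTop_nhds_zero_nat 2
  have hlow := h.sub hsmall
  rw [sub_zero] at hlow
  have hiff : ∀ᶠ n : ℕ in atTop, ∀ i : ℕ,
      ((i.primeFactors.card : ℝ) - Real.log (Real.log n)) / √(Real.log (Real.log n)) ≤ y ↔
        (i.primeFactors.card : ℝ) - Real.log (Real.log n) ≤ y * √(Real.log (Real.log n)) := by
    filter_upwards [tendsto_loglog_natCast_atTop.eventually_gt_atTop 0] with n hn i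
    exact div_le_iff₀ (Real.sqrt_pos.2 hn)
  refine tendsto_of_tendsto_of_tendsto_of_le_of_le' hlow h ?_ ?_
  · filter_upwards [hiff] with n hn
    rw [← sub_div]
    refine div_le_div_of_nonneg_right ?_ n.cast_nonneg
    simp_rw [hn]
    rw [sub_le_iff_le_add]
    have : ((Finset.Ioc 0 n).filter fun i : ℕ => (i.primeFactors.card : ℝ) -
        Real.log (Real.log n) ≤ y * √(Real.log (Real.log n))) ⊆
        ((Finset.Icc 3 n).filter fun i : ℕ => (i.primeFactors.card : ℝ) -
          Real.log (Real.log n) ≤ y * √(Real.log (Real.log n))) ∪ {1, 2} := by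
      intro i
      simp only [Finset.mem_filter, Finset.mem_Ioc, Finset.mem_union, Finset.mem_Icc,
        Finset.mem_insert, Finset.mem_singleton]
      rintro ⟨⟨h0, h1⟩, h2⟩
      by_cases h3 : 3 ≤ i
      · exact Or.inl ⟨⟨h3, h1⟩, h2⟩
      · exact Or.inr (by omega)
    exact_mod_cast (Finset.card_le_card this).trans (Finset.card_union_le _ _)
  · filter_upwards [hiff] with n hn
    refine div_le_div_of_nonneg_right ?_ n.cast_nonneg
    simp_rw [hn]
    refine Nat.cast_le.2 (Finset.card_le_card (Finset.filter_subset_filter _ fun i hi => ?_))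
    rw [Finset.mem_Icc] at hi
    exact Finset.mem_Ioc.2 ⟨by omega, hi.2⟩
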